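/- arXiv:2012.04321 — 2 statements merged into one kernel-verified Lean document; each statement's English description precedes it below -/
import Mathlib

section
/- Let β > 0, 0 < ℰ₂ ≤ E_S, and ℰ₁ = E_S + ℰ₂. For (s,m₁,m₂) ∈ {0,1}³ let the index i = 4s+2m₁+m₂ carry energy h_i = sE_S + m₁ℰ₁ + m₂ℰ₂, and let p ∈ ℝ⁸ have entries p_i = e^{−βh_i}/∑_{j=0}^{7} e^{−βh_j}. Set r_S = p_0+p_1+p_2+p_3 = 1/(1+e^{−βE_S}) and r₁ = 1/(1+e^{−βℰ₁}). Then for every c ∈ [r_S, r₁], the minimum of v·h over all v ∈ ℝ⁸ with v ≺ p and v_0+v_1+v_2+v_3 = c equals p·h + (c−r_S)(ℰ₁−E_S). -/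
set_option linter.unusedSimpArgs false

/-- The sum of the `k` largest entries of `v`, as the supremum of sums over
subsets of cardinality `k`. -/
noncomputable def kMaxSum {n : ℕ} (v : Fin n → ℝ) (k : ℕ) : ℝ :=
  sSup ((fun s : Finset (Fin n) => ∑ i ∈ s, v i) '' {s : Finset (Fin n) | s.card = k})

/-- `IsMajorizedBy v w` means `v ≺ w` : for every `k ≤ n` the sum of the `k` largest
entries of `v` is at most that of `w`, with equal total sums. -/
def IsMajorizedBy {n : ℕ} (v w : Fin n → ℝ) : Prop :=
  (∀ k : ℕ, k ≤ n → kMaxSum v k ≤ kMaxSum w k) ∧ ∑ i, v i = ∑ i, w i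

lemma kMaxSum_bdd {n : ℕ} (v : Fin n → ℝ) (k : ℕ) :
    BddAbove ((fun s : Finset (Fin n) => ∑ i ∈ s, v i) '' {s : Finset (Fin n) | s.card = k}) :=
  ((Set.toFinite _).image _).bddAbove

lemma sum_le_kMaxSum {n : ℕ} (v : Fin n → ℝ) (s : Finset (Fin n)) (k : ℕ) (hs : s.card = k) :
    ∑ i ∈ s, v i ≤ kMaxSum v k :=
  le_csSup (kMaxSum_bdd v k) ⟨s, hs, rfl⟩

lemma kMaxSum_le {n : ℕ} (v : Fin n → ℝ) (k : ℕ) (hk : k ≤ n) (B : ℝ)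
    (hB : ∀ s : Finset (Fin n), s.card = k → ∑ i ∈ s, v i ≤ B) : kMaxSum v k ≤ B := by
  unfold kMaxSum
  apply csSup_le
  · obtain ⟨s, -, hs⟩ := Finset.exists_subset_card_eq
      (s := (Finset.univ : Finset (Fin n))) (n := k) (by simpa using hk)
    exact ⟨_, s, hs, rfl⟩
  · rintro _ ⟨s, hs, rfl⟩
    exact hB s hs

lemma kMaxSum_le_top {n : ℕ} (v : Fin n → ℝ) (S : Finset (Fin n)) (m : ℝ)
    (h1 : ∀ i ∈ S, m ≤ v i) (h2 : ∀ i, i ∉ S → v i ≤ m) :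
    kMaxSum v S.card ≤ ∑ i ∈ S, v i := by
  apply kMaxSum_le
  · simpa using Finset.card_le_univ S
  · intro T hT
    have key : ∑ i ∈ T, (v i - m) ≤ ∑ i ∈ S, (v i - m) := by
      rw [← Finset.sum_inter_add_sum_sdiff T S]
      have a : ∑ i ∈ T \ S, (v i - m) ≤ 0 := Finset.sum_nonpos (fun i hi => by
        have := h2 i (Finset.mem_sdiff.1 hi).2
        linarith)
      have b : ∑ i ∈ T ∩ S, (v i - m) ≤ ∑ i ∈ S, (v i - m) :=
        Finset.sum_le_sum_of_subset_of_nonneg Finset.inter_subset_right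
          (fun i hi _ => by have := h1 i hi; linarith)
      linarith
    simp only [Finset.sum_sub_distrib, Finset.sum_const, hT] at key
    linarith

lemma major_bound {n : ℕ} (v p : Fin n → ℝ) (hv : IsMajorizedBy v p) (S : Finset (Fin n)) (m : ℝ)
    (h1 : ∀ i ∈ S, m ≤ p i) (h2 : ∀ i, i ∉ S → p i ≤ m) :
    ∑ i ∈ S, v i ≤ ∑ i ∈ S, p i :=
  (sum_le_kMaxSum v S _ rfl).trans ((hv.1 _ (by simpa using Finset.card_le_univ S)).trans
    (kMaxSum_le_top p S m h1 h2))

lemma major_mix {n : ℕ} (p : Fin n → ℝ) (σ : Equiv.Perm (Fin n)) (t : ℝ) (h0 : 0 ≤ t)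
    (h1 : t ≤ 1) : IsMajorizedBy (fun i => (1 - t) * p i + t * p (σ i)) p := by
  constructor
  · intro k hk
    apply kMaxSum_le _ _ hk
    intro s hs
    rw [Finset.sum_add_distrib, ← Finset.mul_sum, ← Finset.mul_sum]
    have a := sum_le_kMaxSum p s k hs
    have b := sum_le_kMaxSum p (s.map σ.toEmbedding) k (by simpa using hs)
    rw [Finset.sum_map] at b
    simp only [Equiv.coe_toEmbedding] at b
    nlinarith [mul_le_mul_of_nonneg_left a (sub_nonneg.2 h1), mul_le_mul_of_nonneg_left b h0]
  · rw [Finset.sum_add_distrib, ← Finset.mul_sum, ← Finset.mul_sum, Equiv.sum_comp σ p]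
    ring

theorem two_qubit_machine_optimal_cooling_small_gap
    (β ES ℰ2 : ℝ) (hβ : 0 < β) (hℰ2 : 0 < ℰ2) (hgap : ℰ2 ≤ ES)
    (ℰ1 : ℝ) (hℰ1 : ℰ1 = ES + ℰ2)
    (h : Fin 8 → ℝ)
    (hh : ∀ i : Fin 8, h i = (((i : ℕ) / 4 : ℕ) : ℝ) * ES
      + ((((i : ℕ) / 2) % 2 : ℕ) : ℝ) * ℰ1 + (((i : ℕ) % 2 : ℕ) : ℝ) * ℰ2)
    (p : Fin 8 → ℝ)
    (hp : ∀ i, p i = Real.exp (-(β * h i)) / ∑ j, Real.exp (-(β * h j)))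
    (rS r1 : ℝ) (hrS : rS = p 0 + p 1 + p 2 + p 3)
    (hr1 : r1 = 1 / (1 + Real.exp (-(β * ℰ1))))
    (c : ℝ) (hc1 : rS ≤ c) (hc2 : c ≤ r1) :
    IsLeast {x : ℝ | ∃ v : Fin 8 → ℝ, IsMajorizedBy v p ∧
        v 0 + v 1 + v 2 + v 3 = c ∧ x = ∑ i, v i * h i}
      ((∑ i, p i * h i) + (c - rS) * (ℰ1 - ES)) := by
  have e0 : h 0 = 0 := by rw [hh]; norm_num
  have e1 : h 1 = ℰ2 := by rw [hh]; norm_num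
  have e2 : h 2 = ES + ℰ2 := by rw [hh, hℰ1]; norm_num
  have e3 : h 3 = ES + ℰ2 + ℰ2 := by rw [hh, hℰ1]; norm_num
  have e4 : h 4 = ES := by rw [hh]; norm_num
  have e5 : h 5 = ES + ℰ2 := by rw [hh]; norm_num
  have e6 : h 6 = ES + (ES + ℰ2) := by rw [hh, hℰ1]; norm_num
  have e7 : h 7 = ES + (ES + ℰ2) + ℰ2 := by rw [hh, hℰ1]; norm_num
  clear hh
  have hES : 0 < ES := by linarith
  have hZ : 0 < ∑ j, Real.exp (-(β * h j)) := Finset.sum_pos (fun i _ => Real.exp_pos _) (by simp)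
  have mono : ∀ i j, h i ≤ h j → p j ≤ p i := by
    intro i j hij
    rw [hp, hp]
    gcongr
  constructor
  · -- achievability
    have hfull : r1 = p 0 + p 1 + p 4 + p 5 := by
      have hx := Real.exp_pos (-(β * ES))
      have hy := Real.exp_pos (-(β * ℰ2))
      have f0 : Real.exp (-(β * 0)) = 1 := by simp
      have f2 : Real.exp (-(β * (ES + ℰ2))) = Real.exp (-(β * ES)) * Real.exp (-(β * ℰ2)) := by
        rw [← Real.exp_add]; ring_nf
      have f3 : Real.exp (-(β * (ES + ℰ2 + ℰ2)))
          = Real.exp (-(β * ES)) * Real.exp (-(β * ℰ2)) * Real.exp (-(β * ℰ2)) := by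
        rw [← Real.exp_add, ← Real.exp_add]; ring_nf
      have f6 : Real.exp (-(β * (ES + (ES + ℰ2))))
          = Real.exp (-(β * ES)) * Real.exp (-(β * ES)) * Real.exp (-(β * ℰ2)) := by
        rw [← Real.exp_add, ← Real.exp_add]; ring_nf
      have f7 : Real.exp (-(β * (ES + (ES + ℰ2) + ℰ2)))
          = Real.exp (-(β * ES)) * Real.exp (-(β * ES)) * Real.exp (-(β * ℰ2))
            * Real.exp (-(β * ℰ2)) := by
        rw [← Real.exp_add, ← Real.exp_add, ← Real.exp_add]; ring_nf
      rw [hr1, hp 0, hp 1, hp 4, hp 5, ← add_div, ← add_div, ← add_div,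
        div_eq_div_iff (by positivity) hZ.ne', Fin.sum_univ_eight, e0, e1, e2, e3, e4, e5, e6, e7,
        hℰ1, f0, f2, f3, f6, f7]
      ring
    have h25 : p 2 = p 5 := by rw [hp, hp, e2, e5]
    have hlt : ∃ t, 0 ≤ t ∧ t ≤ 1 ∧ c - rS = t * (r1 - rS) := by
      rcases eq_or_lt_of_le (hc1.trans hc2) with h' | h'
      · exact ⟨0, le_rfl, zero_le_one, by linarith⟩
      · refine ⟨(c - rS) / (r1 - rS), div_nonneg (by linarith) (by linarith),
          (div_le_one (by linarith)).2 (by linarith), ?_⟩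
        rw [div_mul_cancel₀]
        linarith
    obtain ⟨t, ht0, ht1, hct⟩ := hlt
    have s0 : (Equiv.swap (2 : Fin 8) 4 * Equiv.swap 3 5 : Equiv.Perm (Fin 8)) 0 = 0 := by decide
    have s1 : (Equiv.swap (2 : Fin 8) 4 * Equiv.swap 3 5 : Equiv.Perm (Fin 8)) 1 = 1 := by decide
    have s2 : (Equiv.swap (2 : Fin 8) 4 * Equiv.swap 3 5 : Equiv.Perm (Fin 8)) 2 = 4 := by decide
    have s3 : (Equiv.swap (2 : Fin 8) 4 * Equiv.swap 3 5 : Equiv.Perm (Fin 8)) 3 = 5 := by decide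
    have s4 : (Equiv.swap (2 : Fin 8) 4 * Equiv.swap 3 5 : Equiv.Perm (Fin 8)) 4 = 2 := by decide
    have s5 : (Equiv.swap (2 : Fin 8) 4 * Equiv.swap 3 5 : Equiv.Perm (Fin 8)) 5 = 3 := by decide
    have s6 : (Equiv.swap (2 : Fin 8) 4 * Equiv.swap 3 5 : Equiv.Perm (Fin 8)) 6 = 6 := by decide
    have s7 : (Equiv.swap (2 : Fin 8) 4 * Equiv.swap 3 5 : Equiv.Perm (Fin 8)) 7 = 7 := by decide
    refine ⟨_, major_mix p (Equiv.swap (2 : Fin 8) 4 * Equiv.swap 3 5 : Equiv.Perm (Fin 8)) t ht0 ht1, ?_, ?_⟩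
    · simp only [s0, s1, s2, s3]
      rw [hfull, hrS] at hct
      linear_combination -hct
    · rw [Fin.sum_univ_eight, Fin.sum_univ_eight]
      simp only [s0, s1, s2, s3, s4, s5, s6, s7]
      rw [hct, hfull, hrS, e0, e1, e2, e3, e4, e5, e6, e7, hℰ1]
      ring
  · rintro x ⟨v, hv, hvc, rfl⟩
    have b1 := major_bound v p hv {0} (p 0) (fun i hi => mono _ _ (by
      fin_cases i <;> simp at hi ⊢)) (fun i hi => mono _ _ (by
      fin_cases i <;> simp [e0, e1, e2, e3, e4, e5, e6, e7] at hi ⊢ <;> linarith))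
    have b2 := major_bound v p hv {0, 1} (p 1) (fun i hi => mono _ _ (by
      fin_cases i <;> simp [e0, e1, e2, e3, e4, e5, e6, e7] at hi ⊢ <;> linarith))
      (fun i hi => mono _ _ (by
      fin_cases i <;> simp [e0, e1, e2, e3, e4, e5, e6, e7] at hi ⊢ <;> linarith))
    have b4 := major_bound v p hv {0, 1, 2, 4} (p 2) (fun i hi => mono _ _ (by
      fin_cases i <;> simp [e0, e1, e2, e3, e4, e5, e6, e7] at hi ⊢ <;> linarith))
      (fun i hi => mono _ _ (by
      fin_cases i <;> simp [e0, e1, e2, e3, e4, e5, e6, e7] at hi ⊢ <;> linarith))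
    have b6 := major_bound v p hv {0, 1, 2, 3, 4, 5} (p 3) (fun i hi => mono _ _ (by
      fin_cases i <;> simp [e0, e1, e2, e3, e4, e5, e6, e7] at hi ⊢ <;> linarith))
      (fun i hi => mono _ _ (by
      fin_cases i <;> simp [e0, e1, e2, e3, e4, e5, e6, e7] at hi ⊢ <;> linarith))
    have b7 := major_bound v p hv {0, 1, 2, 3, 4, 5, 6} (p 6) (fun i hi => mono _ _ (by
      fin_cases i <;> simp [e0, e1, e2, e3, e4, e5, e6, e7] at hi ⊢ <;> linarith))
      (fun i hi => mono _ _ (by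
      fin_cases i <;> simp [e0, e1, e2, e3, e4, e5, e6, e7] at hi ⊢ <;> linarith))
    have b8 := hv.2
    simp only [Fin.sum_univ_eight] at b8
    simp [Finset.sum_insert] at b1 b2 b4 b6 b7
    rw [Fin.sum_univ_eight, Fin.sum_univ_eight, ← hvc, hrS, e0, e1, e2, e3, e4, e5, e6, e7, hℰ1]
    have c1 := mul_le_mul_of_nonneg_left b1 hℰ2.le
    have c2 := mul_le_mul_of_nonneg_left b2 hES.le
    have c4 := mul_le_mul_of_nonneg_left b4 hℰ2.le
    have c6 := mul_le_mul_of_nonneg_left b6 hES.le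
    have c7 := mul_le_mul_of_nonneg_left b7 hℰ2.le
    have d1 := congrArg (fun z => ES * z) b8
    have d2 := congrArg (fun z => ℰ2 * z) b8
    beta_reduce at d1 d2
    linarith
end

section
/- Let d ≥ 1, let E_0, …, E_{d−1} be real numbers, and let 0 ≤ β' ≤ β. Then the sum of squared Gibbs weights is monotone: ∑_{j=0}^{d−1} p_j(β)² ≥ ∑_{j=0}^{d−1} p_j(β')², where p(γ) denotes the Gibbs vector at inverse temperature γ. -/
/-- The Gibbs probability vector of energies `E` at inverse temperature `β`. -/
noncomputable def gibbs {d : ℕ} (E : Fin d → ℝ) (β : ℝ) : Fin d → ℝ :=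
  fun i => Real.exp (-(β * E i)) / ∑ j, Real.exp (-(β * E j))

lemma gibbs_term {d : ℕ} (E : Fin d → ℝ) (β' β : ℝ) (hβ' : 0 ≤ β') (hββ : β' ≤ β)
    (i j : Fin d) (h : E i ≤ E j) :
    0 ≤ (gibbs E β' i - gibbs E β' j) *
      (gibbs E β i * gibbs E β' j - gibbs E β j * gibbs E β' i) := by
  apply mul_nonneg
  · rw [sub_nonneg]
    unfold gibbs
    have : β' * E i ≤ β' * E j := mul_le_mul_of_nonneg_left h hβ'
    gcongr
  · rw [sub_nonneg]
    unfold gibbs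
    rw [div_mul_div_comm, div_mul_div_comm, ← Real.exp_add, ← Real.exp_add]
    have : -(β * E j) + -(β' * E i) ≤ -(β * E i) + -(β' * E j) := by
      nlinarith [mul_nonneg (sub_nonneg.2 hββ) (sub_nonneg.2 h)]
    gcongr

lemma gibbs_sum {d : ℕ} (hd : 1 ≤ d) (E : Fin d → ℝ) (β : ℝ) : ∑ j, gibbs E β j = 1 := by
  haveI : Nonempty (Fin d) := ⟨⟨0, hd⟩⟩
  unfold gibbs
  rw [← Finset.sum_div]
  exact div_self (Finset.sum_pos (fun _ _ => Real.exp_pos _) Finset.univ_nonempty).ne'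

theorem purity_monotone_in_beta
    (d : ℕ) (hd : 1 ≤ d) (E : Fin d → ℝ)
    (β' β : ℝ) (hβ' : 0 ≤ β') (hββ : β' ≤ β) :
    ∑ j, gibbs E β' j ^ 2 ≤ ∑ j, gibbs E β j ^ 2 := by
  have hp := gibbs_sum hd E β'
  have hq := gibbs_sum hd E β
  have key : 0 ≤ ∑ i, ∑ j, (gibbs E β' i - gibbs E β' j) *
      (gibbs E β i * gibbs E β' j - gibbs E β j * gibbs E β' i) := by
    refine Finset.sum_nonneg fun i _ => Finset.sum_nonneg fun j _ => ?_
    rcases le_total (E i) (E j) with h | h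
    · exact gibbs_term E β' β hβ' hββ i j h
    · linarith [gibbs_term E β' β hβ' hββ j i h]
  generalize gibbs E β' = p at *
  generalize gibbs E β = q at *
  have e : ∑ i, ∑ j, (p i - p j) * (q i * p j - q j * p i)
      = 2 * ∑ i, p i * q i - 2 * ∑ i, p i ^ 2 := by
    have h1 : ∀ i, ∑ j, (p i - p j) * (q i * p j - q j * p i)
        = p i * q i * ∑ j, p j - p i ^ 2 * ∑ j, q j - q i * ∑ j, p j ^ 2
          + p i * ∑ j, p j * q j := by
      intro i
      simp only [Finset.mul_sum, ← Finset.sum_sub_distrib, ← Finset.sum_add_distrib]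
      exact Finset.sum_congr rfl fun j _ => by ring
    simp only [h1, Finset.sum_sub_distrib, Finset.sum_add_distrib, ← Finset.sum_mul, hp, hq]
    ring
  have h2 : 0 ≤ ∑ i, (q i - p i) ^ 2 := Finset.sum_nonneg fun i _ => sq_nonneg _
  have h3 : ∑ i, (q i - p i) ^ 2 = ∑ i, q i ^ 2 - 2 * ∑ i, p i * q i + ∑ i, p i ^ 2 := by
    simp only [Finset.mul_sum, ← Finset.sum_sub_distrib, ← Finset.sum_add_distrib]
    exact Finset.sum_congr rfl fun j _ => by ring
  linarith
end
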